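/- For every real ν > 0, every n ∈ ℕ, and every complex λ, the Taylor coefficients p_{ν,n} of G_{ν,λ} satisfy the difference equation −(ν + 2n) · p_{ν,n}(λ) = (−ν/2 + iλ) · p_{ν,n}(λ + i) − (ν/2 + iλ) · p_{ν,n}(λ − i). -/

import Mathlib

/-- `G_{ν,λ}(x) = (1−x²)^{−ν/2} · exp(iλ · log((1+x)/(1−x)))` for real `x` with `|x| < 1`. -/
noncomputable def GFun (ν : ℝ) (lam : ℂ) (x : ℝ) : ℂ :=
  (((1 - x ^ 2) ^ (-ν / 2) : ℝ) : ℂ) *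
    Complex.exp (Complex.I * lam * (Real.log ((1 + x) / (1 - x)) : ℝ))

open Filter Topology

/-- The formal power series of one real variable with coefficients `a`. -/
noncomputable def seriesOfCoeff (a : ℕ → ℂ) : FormalMultilinearSeries ℝ ℝ ℂ :=
  fun n => ContinuousMultilinearMap.mkPiRing ℝ (Fin n) (a n)

theorem seriesOfCoeff_coeff (a : ℕ → ℂ) (n : ℕ) : (seriesOfCoeff a).coeff n = a n := by
  simp [seriesOfCoeff, FormalMultilinearSeries.coeff]

theorem hasFPowerSeriesAt_seriesOfCoeff {a : ℕ → ℂ} {f : ℝ → ℂ}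
    (h : ∀ᶠ x : ℝ in 𝓝 0, HasSum (fun k : ℕ => a k * (x : ℂ) ^ k) (f x)) :
    HasFPowerSeriesAt f (seriesOfCoeff a) 0 := by
  rw [hasFPowerSeriesAt_iff]
  filter_upwards [h] with x hx
  simpa [seriesOfCoeff_coeff, Complex.real_smul, mul_comm] using hx

theorem coeff_unique {a b : ℕ → ℂ} {f : ℝ → ℂ}
    (ha : ∀ᶠ x : ℝ in 𝓝 0, HasSum (fun k : ℕ => a k * (x : ℂ) ^ k) (f x))
    (hb : ∀ᶠ x : ℝ in 𝓝 0, HasSum (fun k : ℕ => b k * (x : ℂ) ^ k) (f x)) : a = b := by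
  funext n
  rw [← seriesOfCoeff_coeff a, ← seriesOfCoeff_coeff b,
    (hasFPowerSeriesAt_seriesOfCoeff ha).eq_formalMultilinearSeries
      (hasFPowerSeriesAt_seriesOfCoeff hb)]

/-- Termwise action of the Euler operator `x d/dx` on a power series. -/
theorem hasSum_mul_deriv {a : ℕ → ℂ} {f : ℝ → ℂ}
    (h : ∀ᶠ x : ℝ in 𝓝 0, HasSum (fun k : ℕ => a k * (x : ℂ) ^ k) (f x)) :
    ∀ᶠ x : ℝ in 𝓝 0, HasSum (fun k : ℕ => (k * a k) * (x : ℂ) ^ k) (x * deriv f x) := by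
  obtain ⟨r, hr⟩ := hasFPowerSeriesAt_seriesOfCoeff h
  have hd := hasFPowerSeriesAt_iff.1 hr.fderiv.hasFPowerSeriesAt
  filter_upwards [hd] with x hx
  have h1 := (hx.mapL (ContinuousLinearMap.apply ℝ ℂ (1 : ℝ))).mul_left (x : ℂ)
  rw [← hasSum_nat_add_iff' 1]
  simp only [Finset.range_one, Finset.sum_singleton, Nat.cast_zero, zero_mul, sub_zero]
  simp only [ContinuousLinearMap.apply_apply, zero_add, fderiv_apply_one_eq_deriv] at h1
  refine h1.congr_fun fun k => ?_
  simp only [smul_apply, FormalMultilinearSeries.derivSeries_coeff_one,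
    seriesOfCoeff_coeff, Complex.real_smul, nsmul_eq_mul]
  push_cast
  ring

theorem GFun_add_I (ν : ℝ) (lam : ℂ) {x : ℝ} (hx : |x| < 1) :
    GFun ν (lam + Complex.I) x = GFun ν lam x * ((1 - x) / (1 + x)) := by
  obtain ⟨h1, h2⟩ := abs_lt.1 hx
  have hp : 0 < (1 + x) / (1 - x) := div_pos (by linarith) (by linarith)
  have he : Complex.I * (lam + Complex.I) * (Real.log ((1 + x) / (1 - x)) : ℝ) =
      Complex.I * lam * (Real.log ((1 + x) / (1 - x)) : ℝ) -
        (Real.log ((1 + x) / (1 - x)) : ℝ) := by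
    linear_combination (Real.log ((1 + x) / (1 - x)) : ℂ) * Complex.I_mul_I
  rw [GFun, GFun, he, Complex.exp_sub, ← Complex.ofReal_exp, Real.exp_log hp]
  push_cast
  rw [div_div_eq_mul_div]
  ring

theorem GFun_sub_I (ν : ℝ) (lam : ℂ) {x : ℝ} (hx : |x| < 1) :
    GFun ν (lam - Complex.I) x = GFun ν lam x * ((1 + x) / (1 - x)) := by
  obtain ⟨h1, h2⟩ := abs_lt.1 hx
  have hp : 0 < (1 + x) / (1 - x) := div_pos (by linarith) (by linarith)
  have he : Complex.I * (lam - Complex.I) * (Real.log ((1 + x) / (1 - x)) : ℝ) =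
      Complex.I * lam * (Real.log ((1 + x) / (1 - x)) : ℝ) +
        (Real.log ((1 + x) / (1 - x)) : ℝ) := by
    linear_combination -(Real.log ((1 + x) / (1 - x)) : ℂ) * Complex.I_mul_I
  rw [GFun, GFun, he, Complex.exp_add, ← Complex.ofReal_exp, Real.exp_log hp]
  push_cast
  ring

theorem hasDerivAt_GFun (ν : ℝ) (lam : ℂ) {x : ℝ} (hx : |x| < 1) :
    HasDerivAt (GFun ν lam)
      (GFun ν lam x * ((ν * x + 2 * Complex.I * lam) / (1 - (x : ℂ) ^ 2))) x := by
  obtain ⟨h1, h2⟩ := abs_lt.1 hx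
  have ha : 0 < 1 + x := by linarith
  have hb : 0 < 1 - x := by linarith
  have hc : 0 < 1 - x ^ 2 := by nlinarith
  have hc' : (1 - (x : ℂ) ^ 2) ≠ 0 := by exact_mod_cast hc.ne'
  have hlog : HasDerivAt (fun y : ℝ => Real.log ((1 + y) / (1 - y))) (2 / (1 - x ^ 2)) x := by
    have := (((hasDerivAt_id' x).const_add 1).fun_div ((hasDerivAt_id' x).const_sub 1) hb.ne').log
      (div_pos ha hb).ne'
    convert this using 1
    have : 1 - x ^ 2 = (1 + x) * (1 - x) := by ring
    rw [this]
    field_simp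
    ring
  have hpow : HasDerivAt (fun y : ℝ => (1 - y ^ 2) ^ (-ν / 2))
      ((1 - x ^ 2) ^ (-ν / 2) * (ν * x / (1 - x ^ 2))) x := by
    have := (((hasDerivAt_id' x).fun_pow 2).const_sub 1).rpow_const (p := -ν / 2) (Or.inl hc.ne')
    convert this using 1
    rw [Real.rpow_sub_one hc.ne']
    field_simp
    norm_num
    ring
  have := hpow.ofReal_comp.mul ((hlog.ofReal_comp.const_mul (Complex.I * lam)).cexp)
  refine this.congr_deriv ?_
  rw [GFun]
  push_cast
  field_simp

theorem GFun_difference_eq (ν : ℝ) (lam : ℂ) {x : ℝ} (hx : |x| < 1) :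
    -(ν * GFun ν lam x + 2 * (x * deriv (GFun ν lam) x)) =
      (-(ν / 2 : ℂ) + Complex.I * lam) * GFun ν (lam + Complex.I) x -
        ((ν / 2 : ℂ) + Complex.I * lam) * GFun ν (lam - Complex.I) x := by
  obtain ⟨h1, h2⟩ := abs_lt.1 hx
  have ha : (1 + x : ℂ) ≠ 0 := by
    exact_mod_cast (by linarith : (0 : ℝ) < 1 + x).ne'
  have hb : (1 - x : ℂ) ≠ 0 := by
    exact_mod_cast (by linarith : (0 : ℝ) < 1 - x).ne'
  rw [(hasDerivAt_GFun ν lam hx).deriv, GFun_add_I ν lam hx, GFun_sub_I ν lam hx,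
    show (1 - (x : ℂ) ^ 2) = (1 + x) * (1 - x) by ring]
  field_simp
  ring

theorem meixner_pollaczek_difference_eq (ν : ℝ) (hν : 0 < ν) (n : ℕ) (lam : ℂ)
    (p : ℂ → ℕ → ℂ)
    (hp : ∀ μ : ℂ, ∃ r > 0, ∀ x : ℝ, |x| < r →
      HasSum (fun k : ℕ => p μ k * (x : ℂ) ^ k) (GFun ν μ x)) :
    -((ν : ℂ) + 2 * n) * p lam n =
      (-(ν / 2 : ℂ) + Complex.I * lam) * p (lam + Complex.I) n -
        ((ν / 2 : ℂ) + Complex.I * lam) * p (lam - Complex.I) n := by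
  have hsmall : ∀ r > 0, ∀ᶠ x : ℝ in 𝓝 0, |x| < r := fun r hr => by
    simpa using Metric.ball_mem_nhds (0 : ℝ) hr |> eventually_mem_set.2
  have hs : ∀ μ : ℂ, ∀ᶠ x : ℝ in 𝓝 0,
      HasSum (fun k : ℕ => p μ k * (x : ℂ) ^ k) (GFun ν μ x) := fun μ => by
    obtain ⟨r, hr, h⟩ := hp μ
    exact (hsmall r hr).mono h
  refine congrFun (coeff_unique
    (a := fun n : ℕ => -((ν : ℂ) + 2 * n) * p lam n)
    (b := fun n => (-(ν / 2 : ℂ) + Complex.I * lam) * p (lam + Complex.I) n -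
        ((ν / 2 : ℂ) + Complex.I * lam) * p (lam - Complex.I) n)
    (f := fun x => -(ν * GFun ν lam x + 2 * (x * deriv (GFun ν lam) x))) ?_ ?_) n
  · filter_upwards [hs lam, hasSum_mul_deriv (hs lam)] with x h0 h1
    refine ((h0.mul_left (ν : ℂ)).add (h1.mul_left 2)).neg.congr_fun fun k => ?_
    ring
  · filter_upwards [hs (lam + Complex.I), hs (lam - Complex.I), hsmall 1 one_pos] with x h0 h1 hx
    rw [GFun_difference_eq ν lam hx]
    refine ((h0.mul_left (-(ν / 2 : ℂ) + Complex.I * lam)).sub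
      (h1.mul_left ((ν / 2 : ℂ) + Complex.I * lam))).congr_fun fun k => ?_
    ring
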